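/- Let p = (p_1,…,p_m), q = (q_1,…,q_n), r = (r_1,…,r_k) be vectors of positive integers, let G = C_{p:q:r} be the associated compact graph of type 3, and let i ≥ 1 be an integer. Then the number of vertex subsets W ⊆ V(G) such that the induced subgraph of G on W is a compact graph having exactly i+1 minimal cycles equals C(m+n+k+1, i+1) − Σ_{a+b+c=i+1, a≥1, b≥1, c≥1} C(m,a)·C(n,b)·C(k,c), where C(·,·) denotes the binomial coefficient. -/

import Mathlib

open CategoryTheory MvPolynomial Finset
open scoped Classical

noncomputable section

namespace Paper

/-- The monomial `x_u * x_v` associated to an unordered pair `{u, v}` of vertices. -/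
def edgeMon (K : Type*) [CommRing K] {V : Type*} (e : Sym2 V) : MvPolynomial V K :=
  Sym2.lift ⟨fun u v => X u * X v, fun u v => mul_comm _ _⟩ e

/-- The `K`-algebra map `K[E(G)] → K[V(G)]` sending the variable of an edge `{u,v}` to
`x_u * x_v`. -/
def edgeHom (K : Type*) [CommRing K] {V : Type*} (G : SimpleGraph V) :
    MvPolynomial G.edgeSet K →ₐ[K] MvPolynomial V K :=
  aeval (fun e => edgeMon K (e : Sym2 V))

/-- The toric ideal of a simple graph. -/
def toricIdeal (K : Type*) [CommRing K] {V : Type*} (G : SimpleGraph V) :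
    Ideal (MvPolynomial G.edgeSet K) :=
  RingHom.ker (edgeHom K G).toRingHom

/-- The edge ring `K[G] = K[E(G)]/I_G`. -/
abbrev edgeRing (K : Type*) [CommRing K] {V : Type*} (G : SimpleGraph V) :=
  MvPolynomial G.edgeSet K ⧸ toricIdeal K G

open CategoryTheory.Limits in
/-- The projective dimension of a module, as an element of `ℕ∞`:  the least `n` such that `M`
admits a projective resolution vanishing in homological degrees `> n` (or `⊤` if there is
no such finite resolution). -/
def projDim (R : Type*) [CommRing R] (M : ModuleCat R) : ℕ∞ :=
  sInf {n : ℕ∞ | ∃ m : ℕ, (m : ℕ∞) = n ∧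
    ∃ P : ProjectiveResolution M, ∀ i : ℕ, m < i → IsZero (P.complex.X i)}

/-- The 0-1 vector `ε_u + ε_v` attached to an unordered pair `{u,v}` with `u ≠ v`. -/
def edgeVec {V : Type*} (e : Sym2 V) : V → ℝ :=
  fun v => if v ∈ e then 1 else 0

/-- The edge cone of a finite simple graph: all nonnegative real combinations of the vectors
`v_e = ε_u + ε_v`, for `e = {u,v}` an edge of `G`. -/
def edgeCone {V : Type*} [Fintype V] (G : SimpleGraph V) : Set (V → ℝ) :=
  {x | ∃ a : Sym2 V → ℝ, (∀ e, 0 ≤ a e) ∧ (∀ e, e ∉ G.edgeSet → a e = 0) ∧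
    x = ∑ e : Sym2 V, a e • edgeVec e}

/-- A vector has integer coordinates. -/
def IsIntegralVec {V : Type*} (x : V → ℝ) : Prop := ∀ v, ∃ n : ℤ, x v = n

/-- A minimal vector of `relint(ℝ₊(G)) ∩ ℤ^{V(G)}`. -/
def IsMinimalVec {V : Type*} [Fintype V] (G : SimpleGraph V) (x : V → ℝ) : Prop :=
  x ∈ intrinsicInterior ℝ (edgeCone G) ∧ IsIntegralVec x ∧
    ¬ ∃ y z : V → ℝ, (y ∈ intrinsicInterior ℝ (edgeCone G) ∧ IsIntegralVec y) ∧
      (z ∈ edgeCone G ∧ IsIntegralVec z ∧ z ≠ 0) ∧ x = y + z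

/-! ### Multi-path graphs.  `c i` is the number of interior vertices of the `i`-th path,
so the `i`-th path has length `c i + 1`. -/

/-- Vertices of the multi-path graph: `Sum.inl 0 = v1`, `Sum.inl 1 = v2`, and
`Sum.inr ⟨i, j⟩ = u_{i,j+1}`, the `(j+1)`-st interior vertex of the `i`-th path. -/
abbrev MPV {m : ℕ} (c : Fin m → ℕ) : Type := Fin 2 ⊕ (Σ i : Fin m, Fin (c i))

def mpRel {m : ℕ} (c : Fin m → ℕ) : MPV c → MPV c → Prop
  | Sum.inl a, Sum.inr ⟨i, j⟩ => (a = 0 ∧ (j : ℕ) = 0) ∨ (a = 1 ∧ (j : ℕ) + 1 = c i)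
  | Sum.inr ⟨i, j⟩, Sum.inr ⟨i', j'⟩ => (i : ℕ) = i' ∧ (j' : ℕ) = (j : ℕ) + 1
  | _, _ => False

/-- The multi-path graph with `m` paths, the `i`-th of which has `c i` interior vertices
(hence length `c i + 1`), all starting at `v1 = Sum.inl 0` and ending at `v2 = Sum.inl 1`. -/
def multiPath {m : ℕ} (c : Fin m → ℕ) : SimpleGraph (MPV c) :=
  SimpleGraph.fromRel (mpRel c)

/-! ### The two-ear graph `G_m` and the one-ear graph `P_m`. -/

/-- Vertices of the two-ear graph:  `Sum.inl 0 = v1`, `Sum.inl 1 = v2`, `Sum.inl 2 = x1`,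
`Sum.inl 3 = x2`, `Sum.inl 4 = y1`, `Sum.inl 5 = y2`, and `Sum.inr i = u_{i+1}`. -/
abbrev TEV (m : ℕ) : Type := Fin 6 ⊕ Fin (m - 1)

def teRel (m : ℕ) : TEV m → TEV m → Prop
  | Sum.inl a, Sum.inl b =>
      (a = 0 ∧ b = 2) ∨ (a = 0 ∧ b = 3) ∨ (a = 2 ∧ b = 3) ∨ (a = 1 ∧ b = 4) ∨
      (a = 1 ∧ b = 5) ∨ (a = 4 ∧ b = 5) ∨ (a = 2 ∧ b = 4)
  | Sum.inl a, Sum.inr _ => a = 0 ∨ a = 1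
  | _, _ => False

/-- The two-ear graph `𝐆_m`. -/
def twoEar (m : ℕ) : SimpleGraph (TEV m) := SimpleGraph.fromRel (teRel m)

/-- The one-ear graph `𝐏_m`, the induced subgraph of `𝐆_m` on the complement of `x2`. -/
def oneEar (m : ℕ) : SimpleGraph ({v : TEV m | v ≠ Sum.inl 3} : Set (TEV m)) :=
  (twoEar m).induce {v : TEV m | v ≠ Sum.inl 3}

/-! ### Cycles, the odd-cycle condition, and compact graphs. -/

/-- The odd-cycle condition: any two vertex-disjoint odd cycles are joined by an edge. -/
def OddCycleCondition {V : Type*} (G : SimpleGraph V) : Prop :=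
  ∀ (a b : V) (c₁ : G.Walk a a) (c₂ : G.Walk b b), c₁.IsCycle → c₂.IsCycle →
    Odd c₁.length → Odd c₂.length →
    (∀ x, x ∈ c₁.support → x ∉ c₂.support) →
    ∃ x ∈ c₁.support, ∃ y ∈ c₂.support, G.Adj x y

/-- `G` has no even cycle. -/
def HasNoEvenCycle {V : Type*} (G : SimpleGraph V) : Prop :=
  ∀ (a : V) (c : G.Walk a a), c.IsCycle → ¬ Even c.length

/-- A compact graph: connected, all degrees at least `2`, no even cycle, and the
odd-cycle condition holds. -/
def IsCompactGraph {V : Type*} (G : SimpleGraph V) : Prop :=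
  G.Connected ∧ (∀ v : V, 2 ≤ (G.neighborSet v).ncard) ∧ HasNoEvenCycle G ∧ OddCycleCondition G

/-- The number `t(G)` of minimal (= induced) cycles of `G`, counted via their vertex sets. -/
def cycleCount {V : Type*} (G : SimpleGraph V) : ℕ :=
  Set.ncard {S : Set V | ∃ (a : V) (c : G.Walk a a), c.IsCycle ∧
    (∀ x y, x ∈ c.support → y ∈ c.support → G.Adj x y → s(x, y) ∈ c.edges) ∧
    S = {x | x ∈ c.support}}


/-- Vertices of the compact graph of type 3, `C_{p:q:r}`:  the three big vertices
`u = Sum.inl 0`, `v = Sum.inl 1`, `w = Sum.inl 2` form a triangle; the remaining vertices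
are the interiors of the odd cycles through `u`, `v` and `w` respectively. -/
abbrev CV {m n k : ℕ} (p : Fin m → ℕ) (q : Fin n → ℕ) (r : Fin k → ℕ) : Type :=
  Fin 3 ⊕ ((Σ i : Fin m, Fin (2 * p i)) ⊕
    ((Σ i : Fin n, Fin (2 * q i)) ⊕ (Σ i : Fin k, Fin (2 * r i))))

def cRel {m n k : ℕ} (p : Fin m → ℕ) (q : Fin n → ℕ) (r : Fin k → ℕ) :
    CV p q r → CV p q r → Prop
  | Sum.inl a, Sum.inl b => ((a : ℕ) + 1 = (b : ℕ)) ∨ (a = 0 ∧ b = 2)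
  | Sum.inl a, Sum.inr (Sum.inl ⟨i, j⟩) => a = 0 ∧ ((j : ℕ) = 0 ∨ (j : ℕ) + 1 = 2 * p i)
  | Sum.inl a, Sum.inr (Sum.inr (Sum.inl ⟨i, j⟩)) =>
      a = 1 ∧ ((j : ℕ) = 0 ∨ (j : ℕ) + 1 = 2 * q i)
  | Sum.inl a, Sum.inr (Sum.inr (Sum.inr ⟨i, j⟩)) =>
      a = 2 ∧ ((j : ℕ) = 0 ∨ (j : ℕ) + 1 = 2 * r i)
  | Sum.inr (Sum.inl ⟨i, j⟩), Sum.inr (Sum.inl ⟨i', j'⟩) =>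
      (i : ℕ) = i' ∧ (j' : ℕ) = (j : ℕ) + 1
  | Sum.inr (Sum.inr (Sum.inl ⟨i, j⟩)), Sum.inr (Sum.inr (Sum.inl ⟨i', j'⟩)) =>
      (i : ℕ) = i' ∧ (j' : ℕ) = (j : ℕ) + 1
  | Sum.inr (Sum.inr (Sum.inr ⟨i, j⟩)), Sum.inr (Sum.inr (Sum.inr ⟨i', j'⟩)) =>
      (i : ℕ) = i' ∧ (j' : ℕ) = (j : ℕ) + 1
  | _, _ => False

/-- The compact graph of type 3, `C_{p:q:r}`. -/
def typeThree {m n k : ℕ} (p : Fin m → ℕ) (q : Fin n → ℕ) (r : Fin k → ℕ) :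
    SimpleGraph (CV p q r) :=
  SimpleGraph.fromRel (cRel p q r)

section Generic

variable {E : Type*} (L : E → ℕ) (h : E → Fin 3)

/-- Vertices of the generic graph. -/
abbrev GV {E : Type*} (L : E → ℕ) : Type _ := Fin 3 ⊕ (Σ e : E, Fin (L e))

def gAdj : GV L → GV L → Prop
  | Sum.inl a, Sum.inl b => a ≠ b
  | Sum.inl a, Sum.inr ⟨e, j⟩ => h e = a ∧ ((j : ℕ) = 0 ∨ (j : ℕ) + 1 = L e)
  | Sum.inr ⟨e, j⟩, Sum.inl a => h e = a ∧ ((j : ℕ) = 0 ∨ (j : ℕ) + 1 = L e)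
  | Sum.inr ⟨e, j⟩, Sum.inr ⟨e', j'⟩ => e = e' ∧ ((j' : ℕ) = (j : ℕ) + 1 ∨ (j : ℕ) = (j' : ℕ) + 1)

def gGraph : SimpleGraph (GV L) where
  Adj := gAdj L h
  symm := ⟨by
    rintro (a | ⟨e, j⟩) (b | ⟨f, l⟩) hh <;> simp only [gAdj] at hh ⊢
    · exact hh.symm
    · exact hh
    · exact hh
    · exact ⟨hh.1.symm, hh.2.symm⟩⟩
  loopless := ⟨by
    rintro (a | ⟨e, j⟩) hh <;> simp only [gAdj] at hh
    · exact hh rfl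
    · omega⟩

/-- next vertex on the ear -/
def nx (e : E) (j : Fin (L e)) : GV L :=
  if hj : (j : ℕ) + 1 < L e then Sum.inr ⟨e, ⟨j + 1, hj⟩⟩ else Sum.inl (h e)

/-- previous vertex on the ear -/
def pv (e : E) (j : Fin (L e)) : GV L :=
  if (j : ℕ) = 0 then Sum.inl (h e) else Sum.inr ⟨e, ⟨j - 1, by omega⟩⟩

lemma adj_ear_iff (e : E) (j : Fin (L e)) (x : GV L) :
    (gGraph L h).Adj (Sum.inr ⟨e, j⟩) x ↔ x = nx L h e j ∨ x = pv L h e j := by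
  have hj := j.2
  rcases x with b | ⟨f, l⟩
  · simp only [gGraph, gAdj, nx, pv]
    split_ifs <;> simp <;> grind
  · simp only [gGraph, gAdj, nx, pv]
    by_cases hf : e = f
    · subst hf
      have hl := l.2
      split_ifs <;> simp [Fin.ext_iff] <;> omega
    · have hf' : f ≠ e := fun hh => hf hh.symm
      split_ifs <;> simp [hf, hf']

lemma nx_ne_pv (hL : ∀ e, 2 ≤ L e) (e : E) (j : Fin (L e)) : nx L h e j ≠ pv L h e j := by
  have hj := j.2
  have := hL e
  simp only [nx, pv]
  split_ifs <;> simp <;> omega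

/-- The vertex set with hubs `A` and ears `S`. -/
def WW (A : Set (Fin 3)) (S : Set E) : Set (GV L) :=
  {x | Sum.elim (fun a => a ∈ A) (fun y : (Σ e : E, Fin (L e)) => y.1 ∈ S) x}

@[simp] lemma mem_WW_inl (A : Set (Fin 3)) (S : Set E) (a : Fin 3) :
    (Sum.inl a : GV L) ∈ WW L A S ↔ a ∈ A := Iff.rfl
@[simp] lemma mem_WW_inr (A : Set (Fin 3)) (S : Set E) (y : (Σ e : E, Fin (L e))) :
    (Sum.inr y : GV L) ∈ WW L A S ↔ y.1 ∈ S := Iff.rfl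

lemma nx_mem {A : Set (Fin 3)} {S : Set E} (hA : ∀ e ∈ S, h e ∈ A) {e : E} (he : e ∈ S)
    (j : Fin (L e)) : nx L h e j ∈ WW L A S := by
  unfold nx; split_ifs <;> simp [he, hA e he]

lemma pv_mem {A : Set (Fin 3)} {S : Set E} (hA : ∀ e ∈ S, h e ∈ A) {e : E} (he : e ∈ S)
    (j : Fin (L e)) : pv L h e j ∈ WW L A S := by
  unfold pv; split_ifs <;> simp [he, hA e he]

/-- admissible pairs -/
def Adm (A : Set (Fin 3)) (S : Set E) : Prop :=
  A.Nonempty ∧ (∀ e ∈ S, h e ∈ A) ∧ (A = Set.univ ∨ ∀ a ∈ A, ∃ e ∈ S, h e = a)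

lemma adm_deg [Finite E] (hL : ∀ e, 2 ≤ L e) {A : Set (Fin 3)} {S : Set E} (hAd : Adm h A S)
    (v : WW L A S) : 2 ≤ (((gGraph L h).induce (WW L A S)).neighborSet v).ncard := by
  suffices H : 1 < (((gGraph L h).induce (WW L A S)).neighborSet v).ncard from H
  rw [Set.one_lt_ncard_iff]
  suffices H : ∃ a b, a ∈ WW L A S ∧ b ∈ WW L A S ∧ (gGraph L h).Adj v a ∧ (gGraph L h).Adj v b ∧
      a ≠ b by
    obtain ⟨a, b, ha, hb, h1, h2, h3⟩ := H
    exact ⟨⟨a, ha⟩, ⟨b, hb⟩, h1, h2, fun hh => h3 (congrArg Subtype.val hh)⟩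
  obtain ⟨hne, hsub, hor⟩ := hAd
  obtain ⟨(a | ⟨e, j⟩), hv⟩ := v
  · rcases hor with rfl | hor
    · refine ⟨Sum.inl (a + 1), Sum.inl (a + 2), by simp, by simp, ?_, ?_, ?_⟩
      · simp only [gGraph, gAdj]; fin_cases a <;> decide
      · simp only [gGraph, gAdj]; fin_cases a <;> decide
      · simp
    · obtain ⟨e, he, rfl⟩ := hor a hv
      have := hL e
      refine ⟨Sum.inr ⟨e, ⟨0, by omega⟩⟩, Sum.inr ⟨e, ⟨L e - 1, by omega⟩⟩, he, he, ?_, ?_, ?_⟩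
      · simp [gGraph, gAdj]
      · simp only [gGraph, gAdj, true_and]; omega
      · simp; omega
  · exact ⟨nx L h e j, pv L h e j, nx_mem L h hsub hv j, pv_mem L h hsub hv j,
      (adj_ear_iff L h e j _).2 (Or.inl rfl), (adj_ear_iff L h e j _).2 (Or.inr rfl),
      nx_ne_pv L h hL e j⟩

lemma adm_conn {A : Set (Fin 3)} {S : Set E} (hAd : Adm h A S) :
    ((gGraph L h).induce (WW L A S)).Connected := by
  obtain ⟨⟨a0, ha0⟩, hsub, hor⟩ := hAd
  rw [SimpleGraph.connected_iff_exists_forall_reachable]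
  refine ⟨⟨Sum.inl a0, ha0⟩, ?_⟩
  have hhub : ∀ a (ha : a ∈ A), ((gGraph L h).induce (WW L A S)).Reachable
      ⟨Sum.inl a0, ha0⟩ ⟨Sum.inl a, ha⟩ := by
    intro a ha
    by_cases hh : a0 = a
    · subst hh; rfl
    · exact SimpleGraph.Adj.reachable (G := (gGraph L h).induce (WW L A S)) hh
  rintro ⟨(a | ⟨e, ⟨j, hj⟩⟩), hv⟩
  · exact hhub a hv
  · induction j with
    | zero =>
      refine (hhub (h e) (hsub e hv)).trans ?_
      refine SimpleGraph.Adj.reachable ?_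
      simp [gGraph, gAdj]
    | succ j ih =>
      refine (ih (by omega) hv).trans ?_
      refine SimpleGraph.Adj.reachable ?_
      simp [gGraph, gAdj]

lemma exists_cycle {V : Type*} [Finite V] (G : SimpleGraph V) (hc : G.Connected)
    (hd : ∀ v : V, 2 ≤ (G.neighborSet v).ncard) : ∃ (a : V) (c : G.Walk a a), c.IsCycle := by
  by_contra hcon
  push Not at hcon
  have hT : G.IsTree := ⟨hc, fun a c => hcon a c⟩
  have := Fintype.ofFinite V
  obtain ⟨v0⟩ := hc.nonempty
  have : Nontrivial V := by
    have h2 : 1 < (G.neighborSet v0).ncard := hd v0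
    rw [Set.one_lt_ncard_iff] at h2
    obtain ⟨a, b, -, -, hab⟩ := h2
    exact ⟨a, b, hab⟩
  obtain ⟨v, hv⟩ := hT.exists_vert_degree_one_of_nontrivial
  have := hd v
  rw [Set.ncard_eq_toFinset_card'] at this
  rw [← SimpleGraph.card_neighborFinset_eq_degree] at hv
  simp only [SimpleGraph.neighborFinset] at hv
  omega

lemma cycle_closed {V : Type*} {G : SimpleGraph V} {a : V} (c : G.Walk a a) (P : Set V)
    (hP : ∀ x ∈ P, ∀ y, c.toSubgraph.Adj x y → y ∈ P) (x0 : V) (hx0 : x0 ∈ P)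
    (hx0' : x0 ∈ c.support) : ∀ y ∈ c.support, y ∈ P := by
  intro y hy
  have hconn := c.toSubgraph_connected
  have hr := hconn.preconnected ⟨x0, by simpa using hx0'⟩ ⟨y, by simpa using hy⟩
  rw [SimpleGraph.reachable_iff_reflTransGen] at hr
  have : ∀ z : c.toSubgraph.verts, Relation.ReflTransGen c.toSubgraph.coe.Adj ⟨x0, by simpa using hx0'⟩ z →
      (z : V) ∈ P := by
    intro z hz
    induction hz with
    | refl => exact hx0
    | tail _ hab ih => exact hP _ ih _ hab
  exact this _ hr

/-- The triangle. -/
def TT : Set (GV L) := WW L Set.univ ∅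
/-- The ear cycles. -/
def CC (e : E) : Set (GV L) := WW L {h e} {e}

lemma adm_TT : Adm h Set.univ (∅ : Set E) := ⟨⟨0, trivial⟩, by simp, Or.inl rfl⟩
lemma adm_CC (e : E) : Adm h {h e} ({e} : Set E) := ⟨⟨h e, rfl⟩, by simp, Or.inr (by simp)⟩

/-- In a cycle, a vertex having at most two candidate neighbours uses both. -/
lemma cycle_both {V : Type*} {G : SimpleGraph V} {a : V} {c : G.Walk a a} (hc : c.IsCycle)
    {x y z : V} (hx : x ∈ c.support) (hN : ∀ t, c.toSubgraph.Adj x t → t = y ∨ t = z) :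
    c.toSubgraph.Adj x y ∧ c.toSubgraph.Adj x z := by
  have h2 := hc.ncard_neighborSet_toSubgraph_eq_two hx
  rw [Set.ncard_eq_two] at h2
  obtain ⟨s, t, hst, hs⟩ := h2
  have h1 : ∀ w, c.toSubgraph.Adj x w ↔ w = s ∨ w = t := by
    intro w
    have : w ∈ c.toSubgraph.neighborSet x ↔ w ∈ ({s, t} : Set V) := by rw [hs]
    simpa using this
  have a1 := hN s ((h1 s).2 (Or.inl rfl))
  have a2 := hN t ((h1 t).2 (Or.inr rfl))
  rw [h1, h1]
  grind

lemma fin3_aux : ∀ b t : Fin 3, b ≠ t → t = b + 1 ∨ t = b + 2 := by decide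

lemma cycle_class (hL : ∀ e, 2 ≤ L e) {a : GV L} (c : (gGraph L h).Walk a a) (hc : c.IsCycle) :
    {x | x ∈ c.support} = TT L ∨ ∃ e, {x | x ∈ c.support} = CC L h e := by
  by_cases hear : ∃ e j, (Sum.inr ⟨e, j⟩ : GV L) ∈ c.support
  · right
    obtain ⟨e, j, hj⟩ := hear
    refine ⟨e, ?_⟩
    have key : ∀ (j : Fin (L e)), (Sum.inr ⟨e, j⟩ : GV L) ∈ c.support →
        c.toSubgraph.Adj (Sum.inr ⟨e, j⟩) (nx L h e j) ∧
        c.toSubgraph.Adj (Sum.inr ⟨e, j⟩) (pv L h e j) := by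
      intro j hj
      exact cycle_both hc hj (fun t ht => (adj_ear_iff L h e j t).1 ht.adj_sub)
    have mem2 : ∀ x y, c.toSubgraph.Adj x y → y ∈ c.support := fun x y hxy => by
      have := hxy.snd_mem; simpa using this
    have down : ∀ t (ht : t < L e), (Sum.inr ⟨e, ⟨t, ht⟩⟩ : GV L) ∈ c.support →
        (Sum.inr ⟨e, ⟨0, by omega⟩⟩ : GV L) ∈ c.support := by
      intro t
      induction t with
      | zero => exact fun _ hh => hh
      | succ t ih =>
        intro ht hh
        refine ih (by omega) ?_
        have := mem2 _ _ (key _ hh).2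
        simpa [pv] using this
    have h0 := down j.1 j.2 hj
    have up : ∀ t (ht : t < L e), (Sum.inr ⟨e, ⟨t, ht⟩⟩ : GV L) ∈ c.support := by
      intro t
      induction t with
      | zero => exact fun _ => h0
      | succ t ih =>
        intro ht
        have := mem2 _ _ (key _ (ih (by omega))).1
        simpa [nx, ht] using this
    have hLe := hL e
    have hub1 : c.toSubgraph.Adj (Sum.inl (h e)) (Sum.inr ⟨e, ⟨0, by omega⟩⟩) := by
      have := (key _ h0).2
      simpa [pv] using this.symm
    have hub2 : c.toSubgraph.Adj (Sum.inl (h e)) (Sum.inr ⟨e, ⟨L e - 1, by omega⟩⟩) := by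
      have := (key _ (up (L e - 1) (by omega))).1
      have h3 : ¬ (L e - 1 + 1 < L e) := by omega
      simpa [nx, h3] using this.symm
    have hubm : (Sum.inl (h e) : GV L) ∈ c.support := mem2 _ _ hub1.symm
    apply Set.Subset.antisymm
    · refine cycle_closed c (CC L h e) ?_ (Sum.inl (h e)) (by simp [CC]) hubm
      rintro (b | ⟨f, l⟩) hx y hy
      · have hb : b = h e := hx
        subst hb
        have h2 := hc.ncard_neighborSet_toSubgraph_eq_two hubm
        rw [Set.ncard_eq_two] at h2
        obtain ⟨s, t, hst, hs⟩ := h2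
        have h1 : ∀ w, c.toSubgraph.Adj (Sum.inl (h e)) w ↔ w = s ∨ w = t := by
          intro w
          have : w ∈ c.toSubgraph.neighborSet (Sum.inl (h e)) ↔ w ∈ ({s, t} : Set (GV L)) := by
            rw [hs]
          simpa using this
        have hne : (Sum.inr ⟨e, ⟨0, by omega⟩⟩ : GV L) ≠ Sum.inr ⟨e, ⟨L e - 1, by omega⟩⟩ := by
          simp; omega
        have m1 : (Sum.inr ⟨e, ⟨0, by omega⟩⟩ : GV L) ∈ CC L h e := by simp [CC]
        have m2 : (Sum.inr ⟨e, ⟨L e - 1, by omega⟩⟩ : GV L) ∈ CC L h e := by simp [CC]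
        rw [h1] at hub1 hub2 hy
        grind
      · have hf : f = e := hx
        subst hf
        rcases (adj_ear_iff L h f l y).1 hy.adj_sub with rfl | rfl
        · exact nx_mem L h (by simp) (by simp) l
        · exact pv_mem L h (by simp) (by simp) l
    · rintro (b | ⟨f, l⟩) hx
      · have hb : b = h e := hx
        subst hb; exact hubm
      · have hf : f = e := hx
        subst hf; exact up l.1 l.2
  · left
    push Not at hear
    have hsub : ∀ x ∈ c.support, ∃ b, x = Sum.inl b := by
      rintro (b | ⟨f, l⟩) hx
      · exact ⟨b, rfl⟩
      · exact absurd hx (hear f l)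
    have step : ∀ b : Fin 3, (Sum.inl b : GV L) ∈ c.support → ∀ d, (Sum.inl d : GV L) ∈ c.support := by
      intro b hb d
      have mem2 : ∀ x y, c.toSubgraph.Adj x y → y ∈ c.support := fun x y hxy => by
        have := hxy.snd_mem; simpa using this
      have := cycle_both hc (y := Sum.inl (b + 1)) (z := Sum.inl (b + 2)) hb (by
        intro t ht
        obtain ⟨t', rfl⟩ := hsub t (mem2 _ _ ht)
        have : b ≠ t' := ht.adj_sub
        simp only [Sum.inl.injEq]
        exact fin3_aux b t' this)
      have h1 := mem2 _ _ this.1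
      have h2 := mem2 _ _ this.2
      have : d = b ∨ d = b + 1 ∨ d = b + 2 := by
        clear h1 h2 this mem2 hb; revert b d; decide
      rcases this with rfl | rfl | rfl <;> assumption
    obtain ⟨a', rfl⟩ := hsub a c.start_mem_support
    ext x
    rcases x with b | ⟨f, l⟩
    · simp only [Set.mem_ofPred_eq, TT, mem_WW_inl, Set.mem_univ, iff_true]
      exact step _ c.start_mem_support b
    · simp only [Set.mem_ofPred_eq, TT, mem_WW_inr, Set.mem_empty_iff_false, iff_false]
      exact hear f l

lemma TT_ne_CC (hL : ∀ e, 2 ≤ L e) (e : E) : TT L ≠ CC L h e := by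
  intro hh
  have := hL e
  have h1 : (Sum.inr ⟨e, ⟨0, by omega⟩⟩ : GV L) ∈ CC L h e := by simp [CC]
  rw [← hh] at h1
  simp [TT] at h1

lemma TT_not_sub_CC (e : E) : ¬ TT L ⊆ CC L h e := by
  intro hh
  have h1 : h e + 1 = h e := hh (show (Sum.inl (h e + 1) : GV L) ∈ TT L by simp [TT])
  simp at h1

lemma CC_not_sub_TT (hL : ∀ e, 2 ≤ L e) (e : E) : ¬ CC L h e ⊆ TT L := by
  intro hh
  have := hL e
  have h1 : (Sum.inr ⟨e, ⟨0, by omega⟩⟩ : GV L) ∈ CC L h e := by simp [CC]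
  simpa [TT] using hh h1

lemma CC_sub (hL : ∀ e, 2 ≤ L e) {e f : E} (hh : CC L h e ⊆ CC L h f) : e = f := by
  have := hL e
  have h1 : (Sum.inr ⟨e, ⟨0, by omega⟩⟩ : GV L) ∈ CC L h e := by simp [CC]
  simpa [CC] using hh h1

lemma TT_sub_WW (A : Set (Fin 3)) (S : Set E) : TT L ⊆ WW L A S ↔ A = Set.univ := by
  constructor
  · intro hh
    ext a
    simpa using hh (show (Sum.inl a : GV L) ∈ TT L by simp [TT])
  · rintro rfl
    rintro (a | y) hx
    · simp
    · simp [TT] at hx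

lemma CC_sub_WW (hL : ∀ e, 2 ≤ L e) (A : Set (Fin 3)) (S : Set E) (hA : ∀ e ∈ S, h e ∈ A) (e : E) :
    CC L h e ⊆ WW L A S ↔ e ∈ S := by
  constructor
  · intro hh
    have := hL e
    have h1 : (Sum.inr ⟨e, ⟨0, by omega⟩⟩ : GV L) ∈ CC L h e := by simp [CC]
    simpa using hh h1
  · intro he
    rintro (a | ⟨f, j⟩) hx
    · have : a = h e := hx
      subst this; exact hA e he
    · have : f = e := hx
      subst this; exact he

/-- sets of cycles -/
def IsCyc (S : Set (GV L)) : Prop := S = TT L ∨ ∃ e, S = CC L h e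

lemma isCyc_two {S : Set (GV L)} (hS : IsCyc L h S) (x : GV L) (hx : x ∈ S) :
    ∃ y z, ∀ t ∈ S, (gGraph L h).Adj x t → t = y ∨ t = z := by
  rcases x with a | ⟨e, j⟩
  · rcases hS with rfl | ⟨e, rfl⟩
    · refine ⟨Sum.inl (a + 1), Sum.inl (a + 2), ?_⟩
      rintro (b | y) hb hab
      · have := fin3_aux a b hab
        simpa using this
      · simp [TT] at hb
    · by_cases hle : 0 < L e
      · refine ⟨Sum.inr ⟨e, ⟨0, hle⟩⟩, Sum.inr ⟨e, ⟨L e - 1, by omega⟩⟩, ?_⟩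
        rintro (b | ⟨f, l⟩) hb hab
        · have h1 : b = h e := hb
          have h2 : a = h e := hx
          have h3 : a ≠ b := hab
          simp_all
        · have h1 : f = e := hb
          subst h1
          have h3 := hab.2
          simp [Fin.ext_iff]; omega
      · refine ⟨Sum.inl 0, Sum.inl 0, ?_⟩
        rintro (b | ⟨f, l⟩) hb hab
        · have h1 : b = h e := hb
          have h2 : a = h e := hx
          have h3 : a ≠ b := hab
          simp_all
        · have h1 : f = e := hb
          subst h1
          have := l.2
          omega
  · exact ⟨nx L h e j, pv L h e j, fun t _ ht => (adj_ear_iff L h e j t).1 ht⟩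

lemma induce_cycle_class (hL : ∀ e, 2 ≤ L e) (W : Set (GV L)) {a : W}
    (c : ((gGraph L h).induce W).Walk a a) (hc : c.IsCycle) :
    IsCyc L h (Subtype.val '' {x | x ∈ c.support}) := by
  let f : (gGraph L h).induce W ↪g gGraph L h := SimpleGraph.Embedding.induce W
  have hc' : (c.map f.toHom).IsCycle := hc.map f.injective
  have := cycle_class L h hL _ hc'
  have e1 : {x | x ∈ (c.map f.toHom).support} = Subtype.val '' {x | x ∈ c.support} := by
    ext x
    rw [SimpleGraph.Walk.support_map]
    simp [f]
  rw [e1] at this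
  exact this

lemma isCyc_sub (hL : ∀ e, 2 ≤ L e) {S T : Set (GV L)} (hS : IsCyc L h S) (hT : IsCyc L h T)
    (hST : S ⊆ T) : S = T := by
  rcases hS with rfl | ⟨e, rfl⟩ <;> rcases hT with rfl | ⟨f, rfl⟩
  · rfl
  · exact absurd hST (TT_not_sub_CC L h f)
  · exact absurd hST (CC_not_sub_TT L h hL e)
  · rw [CC_sub L h hL hST]

lemma isCyc_exists [Finite E] (hL : ∀ e, 2 ≤ L e) {S : Set (GV L)} (hS : IsCyc L h S) :
    ∃ (a : S) (c : ((gGraph L h).induce S).Walk a a), c.IsCycle ∧ ∀ x, x ∈ c.support := by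
  have : ∃ A B, Adm h A B ∧ S = WW L A B := by
    rcases hS with rfl | ⟨e, rfl⟩
    · exact ⟨_, _, adm_TT h, rfl⟩
    · exact ⟨_, _, adm_CC h e, rfl⟩
  obtain ⟨A, B, hAd, hSW⟩ := this
  have hcon : ((gGraph L h).induce S).Connected := by
    rw [hSW]; exact adm_conn L h hAd
  have hdeg : ∀ v : S, 2 ≤ (((gGraph L h).induce S).neighborSet v).ncard := by
    rw [hSW]; exact adm_deg L h hL hAd
  obtain ⟨a, c, hc⟩ := exists_cycle _ hcon hdeg
  refine ⟨a, c, hc, ?_⟩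
  have h1 := induce_cycle_class L h hL S c hc
  have h2 := isCyc_sub L h hL h1 hS (by rintro _ ⟨x, _, rfl⟩; exact x.2)
  intro x
  have : (x : GV L) ∈ Subtype.val '' {x | x ∈ c.support} := by rw [h2]; exact x.2
  obtain ⟨y, hy, hyx⟩ := this
  rw [← Subtype.ext hyx]; exact hy

lemma cycleSets [Finite E] (hL : ∀ e, 2 ≤ L e) (W : Set (GV L)) :
    (fun S : Set W => (Subtype.val '' S : Set (GV L))) ''
      {S : Set W | ∃ (a : W) (c : ((gGraph L h).induce W).Walk a a), c.IsCycle ∧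
    (∀ x y, x ∈ c.support → y ∈ c.support → ((gGraph L h).induce W).Adj x y → s(x, y) ∈ c.edges) ∧
    S = {x | x ∈ c.support}} = {S | S ⊆ W ∧ IsCyc L h S} := by
  ext S
  constructor
  · rintro ⟨_, ⟨a, c, hc, -, rfl⟩, rfl⟩
    refine ⟨?_, induce_cycle_class L h hL W c hc⟩
    rintro _ ⟨x, _, rfl⟩; exact x.2
  · rintro ⟨hSW, hS⟩
    obtain ⟨a, c, hc, hsup⟩ := isCyc_exists L h hL hS
    let f := SimpleGraph.induceHomOfLE (gGraph L h) hSW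
    have hc' : (c.map f.toHom).IsCycle := hc.map f.injective
    have hsupp : Subtype.val '' {x | x ∈ (c.map f.toHom).support} = S := by
      rw [SimpleGraph.Walk.support_map]
      ext x
      constructor
      · rintro ⟨y, hy, rfl⟩
        obtain ⟨z, -, rfl⟩ := List.mem_map.1 hy
        exact z.2
      · intro hx
        exact ⟨⟨x, hSW hx⟩, List.mem_map.2 ⟨⟨x, hx⟩, hsup _, rfl⟩, rfl⟩
    refine ⟨_, ⟨_, c.map f.toHom, hc', ?_, rfl⟩, hsupp⟩
    intro x y hx hy hxy
    have hmem : ∀ x, x ∈ (c.map f.toHom).support → (x : GV L) ∈ S := by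
      intro x hx; rw [← hsupp]; exact ⟨x, hx, rfl⟩
    obtain ⟨s, t, hst⟩ := isCyc_two L h hS x (hmem x hx)
    have hy' := hst y (hmem y hy) hxy
    rw [← SimpleGraph.Walk.adj_toSubgraph_iff_mem_edges]
    have h2 := hc'.ncard_neighborSet_toSubgraph_eq_two hx
    rw [Set.ncard_eq_two] at h2
    obtain ⟨s', t', hst', hs⟩ := h2
    have h1 : ∀ w, (c.map f.toHom).toSubgraph.Adj x w ↔ w = s' ∨ w = t' := by
      intro w
      have : w ∈ (c.map f.toHom).toSubgraph.neighborSet x ↔ w ∈ ({s', t'} : Set _) := by rw [hs]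
      simpa using this
    have key : ∀ w, (c.map f.toHom).toSubgraph.Adj x w → (w : GV L) = s ∨ (w : GV L) = t := by
      intro w hw
      refine hst w (hmem w ?_) hw.adj_sub
      have := hw.snd_mem; simpa using this
    have a1 := key s' ((h1 s').2 (Or.inl rfl))
    have a2 := key t' ((h1 t').2 (Or.inr rfl))
    have a3 : (s' : GV L) ≠ t' := fun hh => hst' (Subtype.ext hh)
    rw [h1, Subtype.ext_iff, Subtype.ext_iff]
    grind

lemma cycleCount_eq [Finite E] (hL : ∀ e, 2 ≤ L e) (W : Set (GV L)) :
    cycleCount ((gGraph L h).induce W) = Set.ncard {S | S ⊆ W ∧ IsCyc L h S} := by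
  rw [← cycleSets L h hL W, Set.ncard_image_of_injective]
  · rfl
  · exact Set.image_injective.2 Subtype.val_injective

lemma cycleCount_WW [Finite E] (hL : ∀ e, 2 ≤ L e) (A : Set (Fin 3)) (S : Set E)
    (hA : ∀ e ∈ S, h e ∈ A) :
    cycleCount ((gGraph L h).induce (WW L A S)) = S.ncard + if A = Set.univ then 1 else 0 := by
  rw [cycleCount_eq L h hL]
  have hinj : Function.Injective (CC L h) := fun e f hh => CC_sub L h hL hh.le
  have : {S' | S' ⊆ WW L A S ∧ IsCyc L h S'} =
      CC L h '' S ∪ (if A = Set.univ then {TT L} else ∅) := by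
    ext S'
    constructor
    · rintro ⟨h1, rfl | ⟨e, rfl⟩⟩
      · right; rw [TT_sub_WW] at h1; simp [h1]
      · left; rw [CC_sub_WW L h hL A S hA] at h1; exact ⟨e, h1, rfl⟩
    · rintro (⟨e, he, rfl⟩ | hT)
      · exact ⟨(CC_sub_WW L h hL A S hA e).2 he, Or.inr ⟨e, rfl⟩⟩
      · split_ifs at hT with hu
        · have : S' = TT L := hT
          subst this
          exact ⟨(TT_sub_WW L A S).2 hu, Or.inl rfl⟩
        · exact absurd hT (by simp)
  rw [this, Set.ncard_union_eq, Set.ncard_image_of_injective _ hinj]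
  · split_ifs <;> simp
  · split_ifs
    · simp only [Set.disjoint_singleton_right, Set.mem_image, not_exists, not_and]
      exact fun e _ hh => TT_ne_CC L h hL e hh.symm
    · simp

lemma cycle_length {V : Type*} {G : SimpleGraph V} {a : V} (c : G.Walk a a) (hc : c.IsCycle) :
    c.length = Set.ncard {x | x ∈ c.support} := by
  have h1 : {x | x ∈ c.support} = ((c.support.tail.toFinset : Finset V) : Set V) := by
    ext x
    simp only [Set.mem_ofPred_eq, List.coe_toFinset]
    constructor
    · intro hx
      rw [SimpleGraph.Walk.mem_support_iff] at hx
      rcases hx with rfl | hx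
      · exact c.end_mem_tail_support hc.not_nil
      · exact hx
    · exact List.mem_of_mem_tail
  rw [h1, Set.ncard_coe_finset, List.toFinset_card_of_nodup hc.support_nodup]
  simp

lemma isCyc_card (hev : ∀ e, Even (L e)) {S : Set (GV L)} (hS : IsCyc L h S) : Odd S.ncard := by
  rcases hS with rfl | ⟨e, rfl⟩
  · have : TT L = Sum.inl '' (Set.univ : Set (Fin 3)) := by
      ext x; rcases x with a | y <;> simp [TT]
    rw [this, Set.ncard_image_of_injective _ Sum.inl_injective, Set.ncard_univ]
    simp; decide
  · have : CC L h e = insert (Sum.inl (h e)) ((fun j => (Sum.inr ⟨e, j⟩ : GV L)) '' Set.univ) := by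
      ext x
      rcases x with a | ⟨f, j⟩
      · simp [CC]
      · simp only [CC, mem_WW_inr, Set.mem_singleton_iff, Set.image_univ, Set.mem_insert_iff,
          Set.mem_range, reduceCtorEq, false_or, Sum.inr.injEq]
        constructor
        · rintro rfl; exact ⟨j, rfl⟩
        · rintro ⟨y, hy⟩; exact (congrArg Sigma.fst hy).symm
    have hinj : Function.Injective (fun j => (Sum.inr ⟨e, j⟩ : GV L)) := by
      intro j j' hh
      simpa using hh
    rw [this, Set.ncard_insert_of_notMem (by simp) (Set.toFinite _),
      Set.ncard_image_of_injective _ hinj, Set.ncard_univ]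
    simpa using (hev e).add_one

lemma isCyc_hub {S : Set (GV L)} (hS : IsCyc L h S) : ∃ a, (Sum.inl a : GV L) ∈ S := by
  rcases hS with rfl | ⟨e, rfl⟩
  · exact ⟨0, by simp [TT]⟩
  · exact ⟨h e, by simp [CC]⟩

lemma adm_compact [Finite E] (hL : ∀ e, 2 ≤ L e) (hev : ∀ e, Even (L e))
    {A : Set (Fin 3)} {S : Set E} (hAd : Adm h A S) :
    IsCompactGraph ((gGraph L h).induce (WW L A S)) := by
  refine ⟨adm_conn L h hAd, adm_deg L h hL hAd, ?_, ?_⟩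
  · intro a c hc hE
    have h1 := isCyc_card L h hev (induce_cycle_class L h hL _ c hc)
    rw [Set.ncard_image_of_injective _ Subtype.val_injective, ← cycle_length c hc] at h1
    exact (Nat.not_even_iff_odd.2 h1) hE
  · intro a b c₁ c₂ hc₁ hc₂ _ _ hdis
    obtain ⟨x, ⟨x', hx', hx⟩⟩ := isCyc_hub L h (induce_cycle_class L h hL _ c₁ hc₁)
    obtain ⟨y, ⟨y', hy', hy⟩⟩ := isCyc_hub L h (induce_cycle_class L h hL _ c₂ hc₂)
    refine ⟨x', hx', y', hy', ?_⟩
    have hne : x ≠ y := by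
      rintro rfl
      have : x' = y' := Subtype.ext (hx.trans hy.symm)
      subst this
      exact hdis _ hx' hy'
    show (gGraph L h).Adj x' y'
    rw [hx, hy]; exact hne

lemma compact_adm [Finite E] (hL : ∀ e, 2 ≤ L e) (W : Set (GV L))
    (hW : IsCompactGraph ((gGraph L h).induce W)) : ∃ A S, Adm h A S ∧ W = WW L A S := by
  obtain ⟨hcon, hdeg, -, -⟩ := hW
  have hdeg' : ∀ v ∈ W, ∃ a b, a ∈ W ∧ b ∈ W ∧ (gGraph L h).Adj v a ∧ (gGraph L h).Adj v b ∧
      a ≠ b := by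
    intro v hv
    have h2 : 1 < (((gGraph L h).induce W).neighborSet ⟨v, hv⟩).ncard := hdeg ⟨v, hv⟩
    rw [Set.one_lt_ncard_iff] at h2
    obtain ⟨a, b, ha, hb, hab⟩ := h2
    exact ⟨a, b, a.2, b.2, ha, hb, fun hh => hab (Subtype.ext hh)⟩
  have hnb : ∀ e j, (Sum.inr ⟨e, j⟩ : GV L) ∈ W → nx L h e j ∈ W ∧ pv L h e j ∈ W := by
    intro e j hj
    obtain ⟨a, b, ha, hb, h1, h2, h3⟩ := hdeg' _ hj
    rw [adj_ear_iff] at h1 h2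
    grind
  have down : ∀ e t (ht : t < L e), (Sum.inr ⟨e, ⟨t, ht⟩⟩ : GV L) ∈ W →
      (Sum.inr ⟨e, ⟨0, by omega⟩⟩ : GV L) ∈ W := by
    intro e t
    induction t with
    | zero => exact fun _ hh => hh
    | succ t ih =>
      intro ht hh
      refine ih (by omega) ?_
      simpa [pv] using (hnb _ _ hh).2
  have pos : ∀ e, 0 < L e := fun e => by have := hL e; omega
  have up : ∀ e, (Sum.inr ⟨e, ⟨0, pos e⟩⟩ : GV L) ∈ W → ∀ t (ht : t < L e),
      (Sum.inr ⟨e, ⟨t, ht⟩⟩ : GV L) ∈ W := by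
    intro e h0 t
    induction t with
    | zero => exact fun _ => h0
    | succ t ih =>
      intro ht
      have := (hnb _ _ (ih (by omega))).1
      simpa [nx, ht] using this
  refine ⟨{a | Sum.inl a ∈ W}, {e | (Sum.inr ⟨e, ⟨0, pos e⟩⟩ : GV L) ∈ W}, ⟨?_, ?_, ?_⟩, ?_⟩
  · obtain ⟨⟨(a | ⟨e, j⟩), hv⟩⟩ := hcon.nonempty
    · exact ⟨a, hv⟩
    · refine ⟨h e, ?_⟩
      have := (hnb _ _ (down e j.1 j.2 hv)).2
      simpa [pv] using this
  · intro e he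
    have := (hnb _ _ he).2
    simpa [pv] using this
  · by_contra hcon
    push Not at hcon
    obtain ⟨hu, a, ha, hno⟩ := hcon
    apply hu
    obtain ⟨x, y, hx, hy, h1, h2, h3⟩ := hdeg' _ ha
    have hinl : ∀ x ∈ W, (gGraph L h).Adj (Sum.inl a) x → ∃ b, x = Sum.inl b ∧ a ≠ b := by
      rintro (b | ⟨e, j⟩) hx hab
      · exact ⟨b, rfl, hab⟩
      · exact absurd hab.1 (hno e (down e j.1 j.2 hx))
    obtain ⟨x', rfl, hx'⟩ := hinl x hx h1
    obtain ⟨y', rfl, hy'⟩ := hinl y hy h2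
    ext b
    simp only [Set.mem_ofPred_eq, Set.mem_univ, iff_true]
    have h4 : x' ≠ y' := fun hh => h3 (by rw [hh])
    have : b = a ∨ b = x' ∨ b = y' := by
      clear h1 h2 h3 hx hy ha hno
      omega
    rcases this with rfl | rfl | rfl <;> assumption
  · ext x
    rcases x with a | ⟨e, j⟩
    · simp
    · exact ⟨fun hj => down e j.1 j.2 hj, fun h0 => up e h0 j.1 j.2⟩

lemma WW_inj (hL : ∀ e, 2 ≤ L e) {A A' : Set (Fin 3)} {S S' : Set E}
    (hh : WW L A S = WW L A' S') : A = A' ∧ S = S' := by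
  constructor
  · ext a
    rw [← mem_WW_inl L A S, hh, mem_WW_inl]
  · ext e
    have := hL e
    rw [← mem_WW_inr L A S ⟨e, ⟨0, by omega⟩⟩, hh, mem_WW_inr]

lemma main_count [Fintype E] (hL : ∀ e, 2 ≤ L e) (hev : ∀ e, Even (L e)) (i : ℕ) :
    Set.ncard {W : Set (GV L) | IsCompactGraph ((gGraph L h).induce W) ∧
        cycleCount ((gGraph L h).induce W) = i + 1} =
      Nat.choose (Fintype.card E + 1) (i + 1) -
        (((univ : Finset E).powersetCard (i + 1)).filter (fun S => ∀ a, ∃ e ∈ S, h e = a)).card := by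
  have e1 : {W : Set (GV L) | IsCompactGraph ((gGraph L h).induce W) ∧
        cycleCount ((gGraph L h).induce W) = i + 1} =
      (fun S : Finset E => WW L Set.univ (S : Set E)) '' ((univ : Finset E).powersetCard i : Set (Finset E)) ∪
      (fun S : Finset E => WW L (h '' S) (S : Set E)) ''
        (((univ : Finset E).powersetCard (i + 1)).filter (fun S => ¬ ∀ a, ∃ e ∈ S, h e = a) : Finset (Finset E)) := by
    ext W
    constructor
    · rintro ⟨hW, hcnt⟩
      obtain ⟨A, S, hAd, rfl⟩ := compact_adm L h hL W hW
      rw [cycleCount_WW L h hL A S hAd.2.1] at hcnt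
      have hS : ((S.toFinset : Finset E) : Set E) = S := by simp
      have hSc : S.ncard = S.toFinset.card := by rw [Set.ncard_eq_toFinset_card']
      by_cases hA : A = Set.univ
      · left
        simp only [hA, if_true] at hcnt
        refine ⟨S.toFinset, ?_, by simp [hA]⟩
        simp only [mem_coe, mem_powersetCard_univ]; omega
      · right
        simp only [hA, if_false] at hcnt
        obtain ⟨-, h2, h3⟩ := hAd
        have h3 := h3.resolve_left hA
        have hAS : h '' S = A := by
          ext a; constructor
          · rintro ⟨e, he, rfl⟩; exact h2 e he
          · intro ha; exact h3 a ha
        refine ⟨S.toFinset, ?_, by simp only [hS, hAS]⟩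
        simp only [mem_coe, mem_filter, mem_powersetCard_univ]
        refine ⟨by omega, fun hall => hA ?_⟩
        rw [← hAS]; ext a
        simpa using hall a
    · rintro (⟨S, hS, rfl⟩ | ⟨S, hS, rfl⟩)
      · have hAd : Adm h Set.univ (S : Set E) := ⟨⟨0, trivial⟩, by simp, Or.inl rfl⟩
        refine ⟨adm_compact L h hL hev hAd, ?_⟩
        rw [cycleCount_WW L h hL _ _ hAd.2.1]
        simpa using hS
      · simp only [mem_coe, mem_filter, mem_powersetCard_univ] at hS
        obtain ⟨hc, hno⟩ := hS
        have hne : S.Nonempty := by rw [← Finset.card_pos]; omega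
        have hAd : Adm h (h '' S) (S : Set E) := by
          refine ⟨?_, fun e he => ⟨e, he, rfl⟩, Or.inr fun a ha => ha⟩
          obtain ⟨e, he⟩ := hne
          exact ⟨h e, e, he, rfl⟩
        refine ⟨adm_compact L h hL hev hAd, ?_⟩
        dsimp only
        rw [cycleCount_WW L h hL _ _ hAd.2.1, if_neg]
        · simpa using hc
        · intro hu
          apply hno
          intro a
          have : a ∈ h '' S := by rw [hu]; trivial
          exact this
  rw [e1, Set.ncard_union_eq, Set.ncard_image_of_injective, Set.ncard_image_of_injective,
    Set.ncard_coe_finset, Set.ncard_coe_finset, Finset.card_powersetCard, Nat.choose_succ_succ']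
  · have := Finset.card_filter_add_card_filter_not (s := (univ : Finset E).powersetCard (i + 1))
      (fun S => ∀ a, ∃ e ∈ S, h e = a)
    rw [Finset.card_powersetCard] at this
    simp only [Finset.card_univ] at this ⊢
    omega
  · intro S S' hh
    exact Finset.coe_injective (WW_inj L hL hh).2
  · intro S S' hh
    exact Finset.coe_injective (WW_inj L hL hh).2
  · rw [Set.disjoint_left]
    rintro _ ⟨S, hS, rfl⟩ ⟨S', hS', hh⟩
    simp only [mem_coe, mem_filter, mem_powersetCard_univ] at hS'
    apply hS'.2
    intro a
    have : a ∈ h '' S' := by rw [(WW_inj L hL hh).1]; trivial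
    exact this

end Generic

section Transport

lemma isCompact_iso {V V' : Type*} {G : SimpleGraph V} {H : SimpleGraph V'} (f : G ≃g H)
    (hG : IsCompactGraph G) : IsCompactGraph H := by
  obtain ⟨h1, h2, h3, h4⟩ := hG
  refine ⟨f.connected_iff.1 h1, ?_, ?_, ?_⟩
  · intro v
    have := h2 (f.symm v)
    rwa [← Nat.card_coe_set_eq, Nat.card_congr (f.mapNeighborSet (f.symm v)), f.apply_symm_apply,
      Nat.card_coe_set_eq] at this
  · intro a c hc
    have := h3 _ (c.map f.symm.toHom) (hc.map f.symm.injective)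
    simpa using this
  · intro a b c₁ c₂ hc₁ hc₂ ho₁ ho₂ hdis
    obtain ⟨x, hx, y, hy, hxy⟩ := h4 _ _ (c₁.map f.symm.toHom) (c₂.map f.symm.toHom)
      (hc₁.map f.symm.injective) (hc₂.map f.symm.injective) (by simpa using ho₁) (by simpa using ho₂)
      (by
        intro x hx hx'
        rw [SimpleGraph.Walk.support_map, List.mem_map] at hx hx'
        obtain ⟨y, hy, rfl⟩ := hx
        obtain ⟨z, hz, hzy⟩ := hx'
        have : z = y := f.symm.injective hzy
        subst this
        exact hdis _ hy hz)
    rw [SimpleGraph.Walk.support_map, List.mem_map] at hx hy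
    obtain ⟨x', hx', rfl⟩ := hx
    obtain ⟨y', hy', rfl⟩ := hy
    exact ⟨x', hx', y', hy', f.symm.map_adj_iff.1 hxy⟩

lemma cycleCount_le {V V' : Type*} [Finite V'] {G : SimpleGraph V} {H : SimpleGraph V'}
    (f : G ≃g H) : cycleCount G ≤ cycleCount H := by
  unfold cycleCount
  refine Set.ncard_le_ncard_of_injOn (fun S => f '' S) ?_
    ((Set.image_injective.2 f.injective).injOn) (Set.toFinite _)
  rintro _ ⟨a, c, hc, hind, rfl⟩
  refine ⟨_, c.map f.toHom, hc.map f.injective, ?_, ?_⟩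
  · intro x y hx hy hxy
    rw [SimpleGraph.Walk.support_map, List.mem_map] at hx hy
    obtain ⟨x', hx', rfl⟩ := hx
    obtain ⟨y', hy', rfl⟩ := hy
    have := hind x' y' hx' hy' (f.map_adj_iff.1 hxy)
    rw [SimpleGraph.Walk.edges_map, List.mem_map]
    exact ⟨_, this, rfl⟩
  · ext x
    simp [SimpleGraph.Walk.support_map]

def induceIso {V V' : Type*} {G : SimpleGraph V} {H : SimpleGraph V'} (f : G ≃g H) (W : Set V) :
    G.induce W ≃g H.induce (f '' W) where
  toEquiv := f.toEquiv.image W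
  map_rel_iff' := by
    intro a b
    exact f.map_adj_iff

lemma count_iso {V V' : Type*} [Finite V] [Finite V'] {G : SimpleGraph V} {H : SimpleGraph V'}
    (f : G ≃g H) (i : ℕ) :
    Set.ncard {W : Set V | IsCompactGraph (G.induce W) ∧ cycleCount (G.induce W) = i} =
    Set.ncard {W : Set V' | IsCompactGraph (H.induce W) ∧ cycleCount (H.induce W) = i} := by
  rw [← Set.ncard_image_of_injective _ (Set.image_injective.2 f.injective)]
  congr 1
  have hcc : ∀ W, cycleCount (G.induce W) = cycleCount (H.induce (f '' W)) := fun W =>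
    le_antisymm (cycleCount_le (induceIso f W)) (cycleCount_le (induceIso f W).symm)
  ext W
  constructor
  · rintro ⟨W, ⟨h1, h2⟩, rfl⟩
    exact ⟨isCompact_iso (induceIso f W) h1, by rw [← hcc, h2]⟩
  · rintro ⟨h1, h2⟩
    obtain ⟨W, rfl⟩ := (Set.image_surjective.2 f.surjective) W
    exact ⟨W, ⟨isCompact_iso (induceIso f W).symm h1, by rw [hcc, h2]⟩, rfl⟩

end Transport

section Concrete

variable {m n k : ℕ} (p : Fin m → ℕ) (q : Fin n → ℕ) (r : Fin k → ℕ)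

/-- Ear lengths. -/
def cL : Fin m ⊕ Fin n ⊕ Fin k → ℕ
  | Sum.inl i => 2 * p i
  | Sum.inr (Sum.inl i) => 2 * q i
  | Sum.inr (Sum.inr i) => 2 * r i

/-- Hub of an ear. -/
def cH (m n k : ℕ) : Fin m ⊕ Fin n ⊕ Fin k → Fin 3
  | Sum.inl _ => 0
  | Sum.inr (Sum.inl _) => 1
  | Sum.inr (Sum.inr _) => 2

def cEquiv : CV p q r ≃ GV (cL p q r) where
  toFun
    | Sum.inl a => Sum.inl a
    | Sum.inr (Sum.inl ⟨i, j⟩) => Sum.inr ⟨Sum.inl i, j⟩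
    | Sum.inr (Sum.inr (Sum.inl ⟨i, j⟩)) => Sum.inr ⟨Sum.inr (Sum.inl i), j⟩
    | Sum.inr (Sum.inr (Sum.inr ⟨i, j⟩)) => Sum.inr ⟨Sum.inr (Sum.inr i), j⟩
  invFun
    | Sum.inl a => Sum.inl a
    | Sum.inr ⟨Sum.inl i, j⟩ => Sum.inr (Sum.inl ⟨i, j⟩)
    | Sum.inr ⟨Sum.inr (Sum.inl i), j⟩ => Sum.inr (Sum.inr (Sum.inl ⟨i, j⟩))
    | Sum.inr ⟨Sum.inr (Sum.inr i), j⟩ => Sum.inr (Sum.inr (Sum.inr ⟨i, j⟩))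
  left_inv := by rintro (a | ⟨i, j⟩ | ⟨i, j⟩ | ⟨i, j⟩) <;> rfl
  right_inv := by rintro (a | ⟨i | i | i, j⟩) <;> rfl

lemma fin3_adj : ∀ a b : Fin 3, a ≠ b ↔
    (((a : ℕ) + 1 = (b : ℕ)) ∨ (a = 0 ∧ b = 2)) ∨ (((b : ℕ) + 1 = (a : ℕ)) ∨ (b = 0 ∧ a = 2)) := by
  decide

def cIso : typeThree p q r ≃g gGraph (cL p q r) (cH m n k) where
  toEquiv := cEquiv p q r
  map_rel_iff' := by
    intro x y
    rw [typeThree, SimpleGraph.fromRel_adj]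
    rcases x with a | ⟨i, j⟩ | ⟨i, j⟩ | ⟨i, j⟩ <;> rcases y with b | ⟨i', j'⟩ | ⟨i', j'⟩ | ⟨i', j'⟩ <;>
      simp only [cEquiv, gGraph, gAdj, Equiv.coe_fn_mk, cRel, cH, cL]
    · rw [← fin3_adj]; simp
    all_goals simp
    all_goals grind

lemma count_fiber (m n k a b c : ℕ) :
    ((univ : Finset (Finset (Fin m ⊕ Fin n ⊕ Fin k))).filter (fun S =>
      S.toLeft.card = a ∧ S.toRight.toLeft.card = b ∧ S.toRight.toRight.card = c)).card =
    Nat.choose m a * Nat.choose n b * Nat.choose k c := by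
  have : ((univ : Finset (Fin m)).powersetCard a ×ˢ ((univ : Finset (Fin n)).powersetCard b ×ˢ
      (univ : Finset (Fin k)).powersetCard c)).card =
      Nat.choose m a * Nat.choose n b * Nat.choose k c := by
    simp [Finset.card_product, mul_assoc]
  rw [← this]
  refine Finset.card_nbij' (fun S => (S.toLeft, S.toRight.toLeft, S.toRight.toRight))
    (fun T => T.1.disjSum (T.2.1.disjSum T.2.2)) ?_ ?_ ?_ ?_
  · intro S hS
    simpa using hS
  · intro T hT
    simpa using hT
  · intro S hS
    simp [Finset.toLeft_disjSum_toRight]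
  · intro T hT
    simp

lemma count_all (m n k i : ℕ) :
    (((univ : Finset (Fin m ⊕ Fin n ⊕ Fin k)).powersetCard (i + 1)).filter
      (fun S => ∀ a, ∃ e ∈ S, cH m n k e = a)).card =
    ∑ a ∈ Finset.Icc 1 i, ∑ b ∈ Finset.Icc 1 (i - a),
          Nat.choose m a * Nat.choose n b * Nat.choose k (i + 1 - a - b) := by
  have key : ∀ S : Finset (Fin m ⊕ Fin n ⊕ Fin k),
      S ∈ (((univ : Finset (Fin m ⊕ Fin n ⊕ Fin k)).powersetCard (i + 1)).filter
      (fun S => ∀ a, ∃ e ∈ S, cH m n k e = a)) ↔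
      S.toLeft.card + S.toRight.toLeft.card + S.toRight.toRight.card = i + 1 ∧
      1 ≤ S.toLeft.card ∧ 1 ≤ S.toRight.toLeft.card ∧ 1 ≤ S.toRight.toRight.card := by
    intro S
    rw [mem_filter, mem_powersetCard_univ, Fin.forall_fin_succ, Fin.forall_fin_succ,
      Fin.forall_fin_succ]
    have e1 := S.card_toLeft_add_card_toRight
    have e2 := S.toRight.card_toLeft_add_card_toRight
    have c1 : (1 ≤ S.toLeft.card) ↔ ∃ e ∈ S, cH m n k e = 0 := by
      rw [Nat.one_le_iff_ne_zero, Finset.card_ne_zero]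
      constructor
      · rintro ⟨x, hx⟩; exact ⟨_, Finset.mem_toLeft.1 hx, rfl⟩
      · rintro ⟨x | x | x, hx, hh⟩
        · exact ⟨x, Finset.mem_toLeft.2 hx⟩
        · simp [cH] at hh
        · simp [cH] at hh
    have c2 : (1 ≤ S.toRight.toLeft.card) ↔ ∃ e ∈ S, cH m n k e = 1 := by
      rw [Nat.one_le_iff_ne_zero, Finset.card_ne_zero]
      constructor
      · rintro ⟨x, hx⟩; exact ⟨_, Finset.mem_toRight.1 (Finset.mem_toLeft.1 hx), rfl⟩
      · rintro ⟨x | x | x, hx, hh⟩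
        · simp [cH] at hh
        · exact ⟨x, Finset.mem_toLeft.2 (Finset.mem_toRight.2 hx)⟩
        · simp [cH] at hh
    have c3 : (1 ≤ S.toRight.toRight.card) ↔ ∃ e ∈ S, cH m n k e = 2 := by
      rw [Nat.one_le_iff_ne_zero, Finset.card_ne_zero]
      constructor
      · rintro ⟨x, hx⟩; exact ⟨_, Finset.mem_toRight.1 (Finset.mem_toRight.1 hx), rfl⟩
      · rintro ⟨x | x | x, hx, hh⟩
        · simp [cH] at hh
        · simp [cH] at hh
        · exact ⟨x, Finset.mem_toRight.2 (Finset.mem_toRight.2 hx)⟩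
    rw [c1, c2, c3, ← e1, ← e2, ← add_assoc]
    simp
  rw [Finset.card_eq_sum_card_fiberwise (f := fun S => S.toLeft.card) (t := Finset.Icc 1 i)]
  · refine Finset.sum_congr rfl fun a ha => ?_
    rw [Finset.mem_Icc] at ha
    rw [Finset.card_eq_sum_card_fiberwise (f := fun S => S.toRight.toLeft.card)
      (t := Finset.Icc 1 (i - a))]
    · refine Finset.sum_congr rfl fun b hb => ?_
      rw [Finset.mem_Icc] at hb
      rw [← count_fiber]
      congr 1
      ext S
      rw [mem_filter, mem_filter, key, mem_filter]
      simp only [mem_univ, true_and]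
      omega
    · intro S hS
      simp only [mem_coe] at hS ⊢
      rw [mem_filter, key] at hS
      rw [Finset.mem_Icc]; omega
  · intro S hS
    simp only [mem_coe] at hS ⊢
    rw [key] at hS
    rw [Finset.mem_Icc]; omega

end Concrete

/-- The number of vertex subsets of `C_{p:q:r}` inducing a compact graph
with exactly `i+1` minimal cycles. -/
theorem statement14 (m n k : ℕ) (p : Fin m → ℕ) (q : Fin n → ℕ) (r : Fin k → ℕ)
    (hp : ∀ i, 1 ≤ p i) (hq : ∀ i, 1 ≤ q i) (hr : ∀ i, 1 ≤ r i) (i : ℕ) (hi : 1 ≤ i) :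
    Set.ncard {W : Set (CV p q r) |
        IsCompactGraph ((typeThree p q r).induce W) ∧
        cycleCount ((typeThree p q r).induce W) = i + 1} =
      Nat.choose (m + n + k + 1) (i + 1) -
        ∑ a ∈ Finset.Icc 1 i, ∑ b ∈ Finset.Icc 1 (i - a),
          Nat.choose m a * Nat.choose n b * Nat.choose k (i + 1 - a - b) := by
  have hL : ∀ e, 2 ≤ cL p q r e := by
    rintro (e | e | e)
    · have := hp e; simp only [cL]; omega
    · have := hq e; simp only [cL]; omega
    · have := hr e; simp only [cL]; omega
  have hev : ∀ e, Even (cL p q r e) := by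
    rintro (e | e | e) <;> simp [cL]
  rw [count_iso (cIso p q r), main_count _ _ hL hev, count_all]
  simp [add_assoc]

end Paper
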